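/- Let X ⊆ FIN_{A⋆} be an infinite block sequence, let f : [X]_A → C be a coloring into a finite set C, and let i ∈ C. Then there exist a finite set F ⊆ [X]_{A⋆} and an infinite block sequence Y ⊆ [X − F]_{A⋆} such that F half-matches Y for color i. -/

import Mathlib

namespace Carlson

/-- The domain of a partial function `ℕ →. B`, encoded as `ℕ → Option B`. -/
def dom {B : Type*} (p : ℕ → Option B) : Set ℕ := {n | p n ≠ none}

/-- `p` is a located word over `B`: a partial function with finite nonempty domain. -/
def IsLW {B : Type*} (p : ℕ → Option B) : Prop := (dom p).Finite ∧ (dom p).Nonempty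

/-- A located variable word over `A` is a located word over `Option A`
(where `none` encodes the variable `⋆`) taking the value `⋆` at least once. -/
def IsLVW {A : Type*} (p : ℕ → Option (Option A)) : Prop :=
  IsLW p ∧ ∃ n, p n = some none

/-- `p < q`: every element of the domain of `p` is below every element of the domain of `q`. -/
def blt {B : Type*} (p q : ℕ → Option B) : Prop :=
  ∀ m ∈ dom p, ∀ n ∈ dom q, m < n

/-- Union `p ∪ q` of two partial functions (`p` takes precedence; for `blt p q`
the domains are disjoint, so this is the genuine union). -/
def pun {B : Type*} (p q : ℕ → Option B) : ℕ → Option B :=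
  fun n => (p n).elim (q n) some

/-- The empty partial function. -/
def emptyW {B : Type*} : ℕ → Option B := fun _ => none

/-- `p[a]`: substitution of the letter `a ∈ A` for the variable `⋆` in a located
variable word. -/
def substA {A : Type*} (p : ℕ → Option (Option A)) (a : A) : ℕ → Option A :=
  fun n => (p n).map fun x => x.getD a

/-- `p[a]` for `a ∈ A ∪ {⋆}` (with `none` encoding `⋆`, so `p[⋆] = p`). -/
def substV {A : Type*} (p : ℕ → Option (Option A)) (a : Option A) : ℕ → Option (Option A) :=
  fun n => (p n).map fun x => x.elim a some

/-- Union of a finite family of partial functions with pairwise disjoint domains. -/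
def famUnion {B : Type*} {k : ℕ} (g : Fin k → ℕ → Option B) : ℕ → Option B :=
  fun n => ((List.ofFn fun i => g i n).filterMap id).head?

/-- A block sequence: a set of located variable words totally ordered by `<`. -/
def IsBlockSeq {A : Type*} (X : Set (ℕ → Option (Option A))) : Prop :=
  (∀ p ∈ X, IsLVW p) ∧ ∀ p ∈ X, ∀ q ∈ X, p = q ∨ blt p q ∨ blt q p

/-- `[X]_A`: located words of the form `p₀[a₀] ∪ ⋯ ∪ p_k[a_k]` with `p₀ < ⋯ < p_k`
all in `X` and `a₀, …, a_k ∈ A`. -/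
def combA {A : Type*} (X : Set (ℕ → Option (Option A))) : Set (ℕ → Option A) :=
  { q | ∃ (k : ℕ) (p : Fin (k + 1) → ℕ → Option (Option A)) (a : Fin (k + 1) → A),
      (∀ i, p i ∈ X) ∧ (∀ i j : Fin (k + 1), i < j → blt (p i) (p j)) ∧
      q = famUnion fun i => substA (p i) (a i) }

/-- `[X]_{A⋆}`: located variable words of the form `p₀[a₀] ∪ ⋯ ∪ p_k[a_k]` with
`p₀ < ⋯ < p_k` all in `X`, `a₀, …, a_k ∈ A ∪ {⋆}`, and `⋆` used at least once. -/
def combV {A : Type*} (X : Set (ℕ → Option (Option A))) : Set (ℕ → Option (Option A)) :=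
  { q | ∃ (k : ℕ) (p : Fin (k + 1) → ℕ → Option (Option A)) (a : Fin (k + 1) → Option A),
      (∀ i, p i ∈ X) ∧ (∀ i j : Fin (k + 1), i < j → blt (p i) (p j)) ∧
      (∃ i, a i = none) ∧ q = famUnion fun i => substV (p i) (a i) }

/-- `X − F`: the elements of `X` whose domain lies entirely above the domains of
all members of `F`. -/
def sminus {B : Type*} (X F : Set (ℕ → Option B)) : Set (ℕ → Option B) :=
  { q ∈ X | ∀ p ∈ F, blt p q }

/-- `dom q ⊆ [0, ℓ)`. -/
def domBelow {B : Type*} (q : ℕ → Option B) (ℓ : ℕ) : Prop := ∀ n ∈ dom q, n < ℓ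

/-- `dom q ⊆ [m, ∞)`. -/
def domAbove {B : Type*} (q : ℕ → Option B) (m : ℕ) : Prop := ∀ n ∈ dom q, m ≤ n

/-- `S^ℓ_p(f) = S^ℓ_{p'}(g)` for colorings of located words: agreement at `q ∪ p`
vs `q ∪ p'` for every located word `q` with domain contained in `[0, ℓ)`.
(Take `p' = emptyW` to express `S^ℓ_p(f) = S^ℓ(g)`.) -/
def SEq {A C : Type*} (f g : (ℕ → Option A) → C) (ℓ : ℕ) (p p' : ℕ → Option A) : Prop :=
  ∀ q : ℕ → Option A, IsLW q → domBelow q ℓ → f (pun q p) = g (pun q p')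

/-- Variant of `SEq` for colorings that are also defined at the empty located word,
i.e. `q` ranges over `FIN_A(0, ℓ) ∪ {∅}`. -/
def SEq0 {A C : Type*} (f g : (ℕ → Option A) → C) (ℓ : ℕ) (p p' : ℕ → Option A) : Prop :=
  ∀ q : ℕ → Option A, (dom q).Finite → domBelow q ℓ → f (pun q p) = g (pun q p')

/-- A coloring `f` is recurrent if for every `ℓ` there is a located variable word `p`
with domain in `[ℓ, ∞)` such that `S^ℓ_{p[a]}(f) = S^ℓ(f)` for every `a ∈ A`. -/
def Recurrent {A C : Type*} (f : (ℕ → Option A) → C) : Prop :=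
  ∀ ℓ : ℕ, ∃ p : ℕ → Option (Option A), IsLVW p ∧ domAbove p ℓ ∧
    ∀ a : A, SEq f f ℓ (substA p a) emptyW

/-- A coloring `f` is uniformly recurrent if for every `ℓ` there is `m > ℓ` such that
for every `p ∈ FIN_A(m, ∞)` there is `q ∈ FIN_A(ℓ, m)` with `S^ℓ_{q ∪ p}(f) = S^ℓ(f)`. -/
def UnifRecurrent {A C : Type*} (f : (ℕ → Option A) → C) : Prop :=
  ∀ ℓ : ℕ, ∃ m : ℕ, ℓ < m ∧ ∀ p : ℕ → Option A, IsLW p → domAbove p m →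
    ∃ q : ℕ → Option A, IsLW q ∧ domAbove q ℓ ∧ domBelow q m ∧
      SEq f f ℓ (pun q p) emptyW

/-- `f` and `g` are weakly proximal: for every `ℓ` there is `p ∈ FIN_A(ℓ, ∞)` with
`S^ℓ_p(f) = S^ℓ_p(g)`. -/
def WeakProx {A C : Type*} (f g : (ℕ → Option A) → C) : Prop :=
  ∀ ℓ : ℕ, ∃ p : ℕ → Option A, IsLW p ∧ domAbove p ℓ ∧ SEq f g ℓ p p

/-- `g` is strongly proximal to `f`: for every `ℓ` there is a located variable word `p`
with domain in `[ℓ, ∞)` such that `S^ℓ(g) = S^ℓ_{p[a]}(g) = S^ℓ_{p[a]}(f)` for all `a ∈ A`. -/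
def StrongProx {A C : Type*} (g f : (ℕ → Option A) → C) : Prop :=
  ∀ ℓ : ℕ, ∃ p : ℕ → Option (Option A), IsLVW p ∧ domAbove p ℓ ∧
    ∀ a : A, SEq g g ℓ emptyW (substA p a) ∧ SEq g f ℓ (substA p a) (substA p a)

/-- `Recurrent` for colorings also defined at the empty located word. -/
def Recurrent0 {A C : Type*} (f : (ℕ → Option A) → C) : Prop :=
  ∀ ℓ : ℕ, ∃ p : ℕ → Option (Option A), IsLVW p ∧ domAbove p ℓ ∧
    ∀ a : A, SEq0 f f ℓ (substA p a) emptyW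

/-- `StrongProx` for colorings also defined at the empty located word. -/
def StrongProx0 {A C : Type*} (g f : (ℕ → Option A) → C) : Prop :=
  ∀ ℓ : ℕ, ∃ p : ℕ → Option (Option A), IsLVW p ∧ domAbove p ℓ ∧
    ∀ a : A, SEq0 g g ℓ emptyW (substA p a) ∧ SEq0 g f ℓ (substA p a) (substA p a)

/-- Agreement of two colorings on all located words with domain in `[0, ℓ)`. -/
def AgreeBelow {A C : Type*} (f g : (ℕ → Option A) → C) (ℓ : ℕ) : Prop :=
  ∀ q : ℕ → Option A, IsLW q → domBelow q ℓ → f q = g q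

/-- Closedness of a class in `C^{FIN_A}` with the product topology (`C` discrete):
a class is closed iff it contains every coloring all of whose finite restrictions
(to located words with domain in `[0, ℓ)`, for each `ℓ`) are matched within the class. -/
def IsClosedColl {A C : Type*} (𝓒 : Set ((ℕ → Option A) → C)) : Prop :=
  ∀ f, (∀ ℓ : ℕ, ∃ g ∈ 𝓒, AgreeBelow f g ℓ) → f ∈ 𝓒

/-- A subshift: a nonempty closed class `𝓒 ⊆ C^{FIN_A}` such that for every `f ∈ 𝓒`,
`ℓ ∈ ℕ` and `p ∈ FIN_A(ℓ, ∞)` there is `g ∈ 𝓒` with `S^ℓ(g) = S^ℓ_p(f)`. -/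
def IsSubshift {A C : Type*} (𝓒 : Set ((ℕ → Option A) → C)) : Prop :=
  𝓒.Nonempty ∧ IsClosedColl 𝓒 ∧
    ∀ f ∈ 𝓒, ∀ ℓ : ℕ, ∀ p : ℕ → Option A, IsLW p → domAbove p ℓ →
      ∃ g ∈ 𝓒, SEq g f ℓ emptyW p

/-- A minimal subshift: no subshift is a proper subset of it. -/
def IsMinimalSubshift {A C : Type*} (𝓒 : Set ((ℕ → Option A) → C)) : Prop :=
  IsSubshift 𝓒 ∧ ∀ 𝓓 : Set ((ℕ → Option A) → C), IsSubshift 𝓓 → 𝓓 ⊆ 𝓒 → 𝓓 = 𝓒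

/-- The orbit closure of a coloring `f`: all `g` such that for every `ℓ` and every
`q ∈ FIN_A(ℓ, ∞)` there is `p ∈ FIN_A(ℓ, ∞)` with `S^ℓ_q(g) = S^ℓ_p(f)`. -/
def orbCl {A C : Type*} (f : (ℕ → Option A) → C) : Set ((ℕ → Option A) → C) :=
  { g | ∀ ℓ : ℕ, ∀ q : ℕ → Option A, IsLW q → domAbove q ℓ →
      ∃ p : ℕ → Option A, IsLW p ∧ domAbove p ℓ ∧ SEq g f ℓ q p }

/-- A variable word over `A`, encoded as a list over `Option A` with `none` = `⋆`:
the variable must occur at least once. -/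
def IsVarWord {A : Type*} (w : List (Option A)) : Prop := none ∈ w

/-- `w[a]`: replace every occurrence of the variable `⋆` by the letter `a`. -/
def substW {A : Type*} (w : List (Option A)) (a : A) : List A :=
  w.map fun x => x.getD a

/-- `⟨(w_n)_{n∈ℕ}⟩_A`: the words `w_{j₀}[a₀] ⋯ w_{j_{k-1}}[a_{k-1}]` extracted from
the sequence `(w_n)`, for `j₀ < ⋯ < j_{k-1}` and letters `a₀, …, a_{k-1} ∈ A`. -/
def extracted {A : Type*} (w : ℕ → List (Option A)) : Set (List A) :=
  { u | ∃ (k : ℕ) (j : Fin (k + 1) → ℕ) (a : Fin (k + 1) → A),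
      StrictMono j ∧ u = (List.ofFn fun i => substW (w (j i)) (a i)).flatten }

open Filter

section CompactSemigroup

variable {M : Type*} [Semigroup M] [TopologicalSpace M] [T2Space M] [CompactSpace M]

/-- A nonempty closed subsemigroup of a compact right topological semigroup contains an idempotent
which is minimal for the order `e ≤ w ↔ e * w = e ∧ w * e = e`. -/
theorem exists_minimal_idempotent (hcont : ∀ r : M, Continuous (· * r)) {K : Set M}
    (hK : IsClosed K) (hne : K.Nonempty) (hmul : ∀ x ∈ K, ∀ y ∈ K, x * y ∈ K) :
    ∃ w ∈ K, w * w = w ∧ ∀ e ∈ K, e * e = e → e * w = e → w * e = e → e = w := by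
  let S : Set (Set M) :=
    {L | IsClosed L ∧ L.Nonempty ∧ L ⊆ K ∧ ∀ x ∈ K, ∀ y ∈ L, x * y ∈ L}
  obtain ⟨L, -, hL⟩ : ∃ L, L ⊆ K ∧ Minimal (· ∈ S) L := by
    refine zorn_superset_nonempty S (fun c hcs hc hcne => ?_) K
      ⟨hK, hne, subset_rfl, hmul⟩
    obtain ⟨L₀, hL₀⟩ := hcne
    have : Nonempty c := ⟨L₀, hL₀⟩
    refine ⟨⋂₀ c, ⟨isClosed_sInter fun t ht => (hcs ht).1, ?_,
      (Set.sInter_subset_of_mem hL₀).trans (hcs hL₀).2.2.1,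
      fun x hx y hy t ht => (hcs ht).2.2.2 x hx y (hy t ht)⟩,
      fun s hs => Set.sInter_subset_of_mem hs⟩
    exact IsCompact.nonempty_sInter_of_directed_nonempty_isCompact_isClosed
      (IsChain.directedOn hc.symm) (fun t ht => (hcs ht).2.1)
      (fun t ht => (hcs ht).1.isCompact) (fun t ht => (hcs ht).1)
  obtain ⟨L_closed, L_ne, L_sub, L_mul⟩ := hL.prop
  obtain ⟨w, hwL, hww⟩ := exists_idempotent_in_compact_subsemigroup hcont L L_ne
    L_closed.isCompact (fun x hx y hy => L_mul x (L_sub hx) y hy)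
  refine ⟨w, L_sub hwL, hww, fun e he hee hew hwe => ?_⟩
  have heL : e ∈ L := hew ▸ L_mul e he w hwL
  have hKe : (· * e) '' K = L := by
    apply hL.eq_of_subset
    · refine ⟨(hcont e).isClosedMap _ hK, hne.image _, ?_, ?_⟩
      · rintro _ ⟨x, hx, rfl⟩
        exact hmul x hx e he
      · rintro x hx _ ⟨y, hy, rfl⟩
        exact ⟨x * y, hmul x hx y hy, mul_assoc _ _ _⟩
    · rintro _ ⟨x, hx, rfl⟩
      exact L_mul x hx e heL
  obtain ⟨x, -, rfl⟩ : w ∈ (· * e) '' K := hKe ▸ hwL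
  simpa [mul_assoc, hee] using hwe.symm

/-- Below an idempotent `w` there is an idempotent in any closed subsemigroup `J` absorbing `w`. -/
theorem exists_idempotent_le (hcont : ∀ r : M, Continuous (· * r)) {w : M} (hw : w * w = w)
    {J : Set M} (hJ : IsClosed J) (hne : J.Nonempty) (hmul : ∀ x ∈ J, ∀ y ∈ J, x * y ∈ J)
    (hleft : ∀ x ∈ J, w * x ∈ J) (hright : ∀ x ∈ J, x * w ∈ J) :
    ∃ v ∈ J, v * v = v ∧ v * w = v ∧ w * v = v := by
  obtain ⟨_, ⟨x, hx, rfl⟩, hu⟩ := exists_idempotent_in_compact_subsemigroup hcont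
    ((· * w) '' J) (hne.image _) (hJ.isCompact.image (hcont w)) (by
      rintro _ ⟨x, hx, rfl⟩ _ ⟨y, hy, rfl⟩
      exact ⟨x * w * y, hmul _ (hright x hx) y hy, by simp [mul_assoc]⟩)
  refine ⟨w * (x * w), hleft _ (hright x hx), ?_, ?_, ?_⟩
  · have hu' : x * (w * (x * w)) = x * w := by simpa [mul_assoc] using hu
    calc w * (x * w) * (w * (x * w)) = w * (x * ((w * w) * (x * w))) := by simp only [mul_assoc]
      _ = w * (x * w) := by rw [hw, hu']
  · simp only [mul_assoc, hw]
  · rw [← mul_assoc, hw]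

end CompactSemigroup

attribute [local instance] Ultrafilter.semigroup

section Tails

variable {T : Type*}

/-- The ultrafilters concentrated on every member of a sequence of sets. -/
def tailUltrafilters (Z : ℕ → Set T) : Set (Ultrafilter T) := {U | ∀ n, Z n ∈ U}

theorem isClosed_tailUltrafilters (Z : ℕ → Set T) : IsClosed (tailUltrafilters Z) := by
  simp only [tailUltrafilters, Set.ofPred_forall]
  exact isClosed_iInter fun n => ultrafilter_isClosed_basic (Z n)

theorem tailUltrafilters_nonempty {Z : ℕ → Set T} (hZ : Antitone Z) (hne : ∀ n, (Z n).Nonempty) :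
    (tailUltrafilters Z).Nonempty := by
  choose z hz using hne
  refine ⟨(hyperfilter ℕ).map z, fun n => ?_⟩
  have : ∀ᶠ k in (hyperfilter ℕ : Filter ℕ), n ≤ k :=
    (Nat.cofinite_eq_atTop ▸ hyperfilter_le_cofinite) (eventually_ge_atTop n)
  exact this.mono fun k hk => hZ hk (hz k)

/-- Left multiplication by a member of `Y n` sends a tail of the sequence `Z` into `P n`. -/
def MulTail [Mul T] (Y Z P : ℕ → Set T) : Prop :=
  ∀ n, ∀ s ∈ Y n, ∃ m, ∀ t ∈ Z m, s * t ∈ P n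

theorem MulTail.mul_mem [Semigroup T] {Y Z P : ℕ → Set T} (h : MulTail Y Z P)
    {U V : Ultrafilter T} (hU : U ∈ tailUltrafilters Y) (hV : V ∈ tailUltrafilters Z) :
    U * V ∈ tailUltrafilters P := by
  intro n
  refine (Ultrafilter.eventually_mul U V (· ∈ P n)).2 ?_
  filter_upwards [hU n] with s hs
  obtain ⟨m, hm⟩ := h n s hs
  filter_upwards [hV m] with t ht using hm t ht

theorem ultrafilter_map_mul {S : Type*} [Semigroup T] [Semigroup S] (φ : T →ₙ* S)
    (U V : Ultrafilter T) : (U * V).map φ = U.map φ * V.map φ := by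
  refine Ultrafilter.coe_inj.mp (Filter.ext' fun p => ?_)
  rw [Ultrafilter.eventually_mul]
  simp only [Ultrafilter.coe_map, eventually_map]
  rw [Ultrafilter.eventually_mul]
  simp

/-- The products built from an infinite sequence of variable elements all lie in a set that is
large for an idempotent ultrafilter `w`, if `w` is the image of an ultrafilter `v` concentrated
on the variable elements under all substitutions. -/
theorem exists_seq_prod_mem {A : Type*} [Finite A] [Monoid T] {V : ℕ → Set T} {σ : A → T →ₙ* T}
    {v w : Ultrafilter T} (hv : v ∈ tailUltrafilters V) (hw : w * w = w)
    (hvw : ∀ a, v.map (σ a) = w) {B : Set T} (hB : B ∈ w) (g : T → ℕ) :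
    ∃ y : ℕ → T, (∀ k, ∃ n, y k ∈ V n) ∧ (∀ k, y (k + 1) ∈ V (g (y k))) ∧
      ∀ l : List (ℕ × A), l ≠ [] → l.Pairwise (fun x x' => x.1 < x'.1) →
        (l.map fun x => σ x.2 (y x.1)).prod ∈ B := by
  have hstep : ∀ (D : {D : Set T // D ∈ w}) (N : ℕ), ∃ y ∈ V N, ∀ a,
      σ a y ∈ D.1 ∧ {t | σ a y * t ∈ D.1} ∈ w := by
    rintro ⟨D, hD⟩ N
    have h1 : ∀ᶠ s in (w : Filter T), s ∈ D ∧ {t | s * t ∈ D} ∈ w := by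
      refine Filter.Eventually.and hD ?_
      rw [← hw] at hD
      exact (Ultrafilter.eventually_mul w w (· ∈ D)).1 hD
    have h2 : ∀ᶠ y in (v : Filter T), ∀ a, σ a y ∈ D ∧ {t | σ a y * t ∈ D} ∈ w := by
      refine eventually_all.2 fun a => ?_
      have h : ∀ᶠ s in (v.map (σ a) : Filter T), s ∈ D ∧ {t | s * t ∈ D} ∈ w := by
        rwa [hvw a]
      exact h
    exact ((show ∀ᶠ y in (v : Filter T), y ∈ V N from hv N).and h2).exists
  choose pick hpickV hpick using hstep
  let next : {D : Set T // D ∈ w} × ℕ → {D : Set T // D ∈ w} × ℕ := fun s =>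
    (⟨s.1.1 ∩ ⋂ a, {t | σ a (pick s.1 s.2) * t ∈ s.1.1},
      inter_mem s.1.2 (iInter_mem.2 fun a => (hpick s.1 s.2 a).2)⟩, g (pick s.1 s.2))
  let st : ℕ → {D : Set T // D ∈ w} × ℕ := fun k => next^[k] (⟨B, hB⟩, 0)
  have hst : ∀ k, st (k + 1) = next (st k) := fun k => Function.iterate_succ_apply' ..
  have hanti : Antitone fun k => (st k).1.1 := antitone_nat_of_succ_le fun k => by
    rw [hst]
    exact Set.inter_subset_left
  refine ⟨fun k => pick (st k).1 (st k).2, fun k => ⟨_, hpickV _ _⟩, fun k => ?_,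
    fun l hl hlt => ?_⟩
  · have h : (st (k + 1)).2 = g (pick (st k).1 (st k).2) := by rw [hst]
    exact h ▸ hpickV (st (k + 1)).1 (st (k + 1)).2
  · suffices h : ∀ (l : List (ℕ × A)) (n : ℕ), l ≠ [] → l.Pairwise (fun x x' => x.1 < x'.1) →
        (∀ x ∈ l, n ≤ x.1) →
        (l.map fun x => σ x.2 (pick (st x.1).1 (st x.1).2)).prod ∈ (st n).1.1 from
      h l 0 hl hlt fun _ _ => Nat.zero_le _
    clear hl hlt l
    intro l
    induction l with
    | nil => simp
    | cons x l ih =>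
      intro n _ hlt hn
      refine hanti (hn x (by simp)) ?_
      rw [List.map_cons, List.prod_cons]
      rcases eq_or_ne l [] with rfl | hl
      · simpa using (hpick (st x.1).1 (st x.1).2 x.2).1
      · have h := ih (x.1 + 1) hl hlt.of_cons fun x' hx' => (List.pairwise_cons.1 hlt).1 x' hx'
        rw [hst] at h
        exact Set.mem_iInter.1 h.2 x.2

/-- An abstract form of Carlson's theorem: `W` is the sequence of tails of the constant elements
of a monoid and `V` that of the variable elements, and `σ a` substitutes the letter `a`. -/
theorem exists_seq_prod_color_eq {A C : Type*} [Finite A] [Nonempty A] [Finite C] [Monoid T]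
    {W V : ℕ → Set T} {σ : A → T →ₙ* T} (hV : Antitone V) (hVne : ∀ n, (V n).Nonempty)
    (hWW : MulTail W W W) (hWV : MulTail W V V) (hVW : MulTail V W V) (hVV : MulTail V V V)
    (hσ : ∀ a n, ∀ t ∈ V n, σ a t ∈ W n) (hσW : ∀ a n, ∀ t ∈ W n, σ a t = t)
    (c : T → C) (g : T → ℕ) :
    ∃ (i : C) (y : ℕ → T), (∀ k, ∃ n, y k ∈ V n) ∧ (∀ k, y (k + 1) ∈ V (g (y k))) ∧
      ∀ l : List (ℕ × A), l ≠ [] → l.Pairwise (fun x x' => x.1 < x'.1) →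
        c (l.map fun x => σ x.2 (y x.1)).prod = i := by
  have hmap : ∀ a, ∀ U ∈ tailUltrafilters V, U.map (σ a) ∈ tailUltrafilters W :=
    fun a U hU n => Ultrafilter.mem_map.2 (mem_of_superset (hU n) fun t => hσ a n t)
  have hJne := tailUltrafilters_nonempty hV hVne
  have hKne : (tailUltrafilters W).Nonempty :=
    hJne.elim fun U hU => ⟨_, hmap (Classical.arbitrary A) U hU⟩
  obtain ⟨w, hwK, hww, hmin⟩ := exists_minimal_idempotent Ultrafilter.continuous_mul_left
    (isClosed_tailUltrafilters W) hKne fun U hU U' hU' => hWW.mul_mem hU hU'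
  obtain ⟨v, hvJ, hvv, hvw, hwv⟩ := exists_idempotent_le Ultrafilter.continuous_mul_left hww
    (isClosed_tailUltrafilters V) hJne (fun U hU U' hU' => hVV.mul_mem hU hU')
    (fun U hU => hWV.mul_mem hwK hU) (fun U hU => hVW.mul_mem hU hwK)
  have hσw : ∀ a, w.map (σ a) = w := fun a => by
    refine Ultrafilter.coe_inj.mp ?_
    rw [Ultrafilter.coe_map]
    exact (map_congr (mem_of_superset (hwK 0) (hσW a 0))).trans map_id
  have hσv : ∀ a, v.map (σ a) = w := fun a => by
    refine hmin _ (hmap a v hvJ) ?_ ?_ ?_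
    · rw [← ultrafilter_map_mul, hvv]
    · conv_lhs => rw [← hσw a, ← ultrafilter_map_mul, hvw]
    · conv_lhs => rw [← hσw a, ← ultrafilter_map_mul, hwv]
  obtain ⟨i, hi⟩ : ∃ i, c ⁻¹' {i} ∈ w := by
    have : (⋃ i, c ⁻¹' {i}) ∈ w := univ_mem' fun t => Set.mem_iUnion.2 ⟨c t, rfl⟩
    rw [← Set.biUnion_univ] at this
    simpa using (Ultrafilter.finite_biUnion_mem_iff Set.finite_univ).1 this
  exact ⟨i, exists_seq_prod_mem hvJ hww hσv hi g⟩

end Tails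

section PartialFunctions

variable {A B : Type*}

/-- The union of a list of partial functions, earlier entries taking precedence. -/
def catW (l : List (ℕ → Option B)) : ℕ → Option B := l.foldr pun emptyW

@[simp] theorem catW_cons (p : ℕ → Option B) (l : List (ℕ → Option B)) :
    catW (p :: l) = pun p (catW l) := rfl

theorem pun_assoc (p q r : ℕ → Option B) : pun (pun p q) r = pun p (pun q r) := by
  funext n
  simp only [pun]
  cases p n <;> rfl

theorem catW_append (l l' : List (ℕ → Option B)) : catW (l ++ l') = pun (catW l) (catW l') := by
  induction l with
  | nil => rfl
  | cons p l ih => rw [List.cons_append, catW_cons, ih, catW_cons, pun_assoc]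

theorem catW_flatten (l : List (List (ℕ → Option B))) : catW l.flatten = catW (l.map catW) := by
  induction l with
  | nil => rfl
  | cons p l ih => rw [List.flatten_cons, catW_append, ih, List.map_cons, catW_cons]

theorem famUnion_eq_catW {k : ℕ} (g : Fin k → ℕ → Option B) :
    famUnion g = catW (List.ofFn g) := by
  funext n
  have h : ∀ l : List (ℕ → Option B),
      ((l.map fun p => p n).filterMap id).head? = catW l n := by
    intro l
    induction l with
    | nil => rfl
    | cons p l ih =>
      rw [List.map_cons, catW_cons, pun, ← ih]
      cases hp : p n <;> simp
  rw [← h, List.map_ofFn]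
  rfl

theorem mem_dom_pun {p q : ℕ → Option B} {n : ℕ} : n ∈ dom (pun p q) ↔ n ∈ dom p ∨ n ∈ dom q := by
  change (p n).elim (q n) some ≠ none ↔ p n ≠ none ∨ q n ≠ none
  cases p n <;> simp

theorem mem_dom_catW {l : List (ℕ → Option B)} {n : ℕ} :
    n ∈ dom (catW l) ↔ ∃ p ∈ l, n ∈ dom p := by
  induction l with
  | nil => simp [catW, dom, emptyW]
  | cons p l ih => simp [mem_dom_pun, ih]

theorem dom_substV (p : ℕ → Option (Option A)) (b : Option A) : dom (substV p b) = dom p := by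
  ext n
  simp [dom, substV]

theorem substA_pun (p q : ℕ → Option (Option A)) (a : A) :
    substA (pun p q) a = pun (substA p a) (substA q a) := by
  funext n
  simp only [substA, pun]
  cases p n <;> rfl

theorem substA_catW (l : List (ℕ → Option (Option A))) (a : A) :
    substA (catW l) a = catW (l.map fun p => substA p a) := by
  induction l with
  | nil => rfl
  | cons p l ih => rw [catW_cons, substA_pun, ih, List.map_cons, catW_cons]

theorem substA_substV (p : ℕ → Option (Option A)) (b : Option A) (a : A) :
    substA (substV p b) a = substA p (b.getD a) := by
  funext n
  simp only [substA, substV, Option.map_map]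
  congr 1
  funext x
  cases x <;> rfl

theorem mem_dom_famUnion {k : ℕ} {g : Fin k → ℕ → Option B} {n : ℕ} :
    n ∈ dom (famUnion g) ↔ ∃ j, n ∈ dom (g j) := by
  simp [famUnion_eq_catW, mem_dom_catW, List.mem_ofFn]

theorem blt_trans {p q r : ℕ → Option B} (hq : (dom q).Nonempty) (hpq : blt p q) (hqr : blt q r) :
    blt p r :=
  fun m hm n hn => hq.elim fun k hk => (hpq m hm k hk).trans (hqr k hk n hn)

theorem mem_combV_sminus {X : Set (ℕ → Option (Option A))} {p r : ℕ → Option (Option A)}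
    (hp : p ∈ combV X) (hr : blt r p) : p ∈ combV (sminus X {r}) := by
  obtain ⟨k, q, a, hq, hlt, hstar, rfl⟩ := hp
  refine ⟨k, q, a, fun j => ⟨hq j, ?_⟩, hlt, hstar, rfl⟩
  rintro _ rfl m hm n hn
  exact hr m hm n (mem_dom_famUnion.2 ⟨j, by rwa [dom_substV]⟩)

theorem famUnion_apply_of_mem_dom {k : ℕ} {g : Fin k → ℕ → Option B}
    (hg : ∀ i j, i < j → blt (g i) (g j)) {j : Fin k} {n : ℕ} (hn : n ∈ dom (g j)) :
    famUnion g n = g j n := by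
  have hne : ∀ i, i ≠ j → g i n = none := fun i hij => by
    by_contra hi
    rcases lt_or_gt_of_ne hij with h | h
    · exact lt_irrefl n (hg i j h n hi n hn)
    · exact lt_irrefl n (hg j i h n hn n hi)
  have hmem : ∀ v ∈ (List.ofFn fun i => g i n).filterMap id, some v = g j n := by
    intro v hv
    obtain ⟨o, ho, hov⟩ := List.mem_filterMap.1 hv
    obtain ⟨i, rfl⟩ := List.mem_ofFn.1 ho
    rcases eq_or_ne i j with rfl | hij
    · exact hov.symm
    · simp [hne i hij] at hov
  have hdom : famUnion g n ≠ none := mem_dom_famUnion.2 ⟨j, hn⟩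
  obtain ⟨v, hv⟩ := Option.ne_none_iff_exists'.1 hdom
  rw [hv]
  exact hmem v (List.mem_of_head? hv)

theorem IsBlockSeq.isLVW_of_mem_combV {X : Set (ℕ → Option (Option A))} (hX : IsBlockSeq X)
    {p : ℕ → Option (Option A)} (hp : p ∈ combV X) : IsLVW p := by
  obtain ⟨k, q, a, hq, hlt, ⟨j, hj⟩, rfl⟩ := hp
  obtain ⟨n, hn⟩ := (hX.1 _ (hq j)).2
  have hlt' : ∀ i j, i < j → blt (substV (q i) (a i)) (substV (q j) (a j)) := fun i j hij => by
    simpa only [blt, dom_substV] using hlt i j hij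
  have hn' : famUnion (fun i => substV (q i) (a i)) n = some none := by
    rw [famUnion_apply_of_mem_dom hlt' (j := j) (by rw [dom_substV]; simp [dom, hn])]
    simp [substV, hn, hj]
  refine ⟨⟨?_, n, by simp [dom, hn']⟩, n, hn'⟩
  refine (Set.finite_iUnion fun i => (hX.1 _ (hq i)).1.1).subset fun m hm => ?_
  obtain ⟨i, hi⟩ := mem_dom_famUnion.1 hm
  exact Set.mem_iUnion.2 ⟨i, by rwa [dom_substV] at hi⟩

theorem IsBlockSeq.exists_domAbove {X : Set (ℕ → Option (Option A))} (hX : IsBlockSeq X)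
    (hXinf : X.Infinite) (n : ℕ) : ∃ p ∈ X, domAbove p n := by
  by_contra! h
  simp only [domAbove, not_forall, not_le] at h
  choose! m hm hmn using h
  refine hXinf (Set.Finite.of_injOn (f := m) (t := Set.Iio n) (fun p hp => hmn p hp) ?_
    (Set.finite_Iio n))
  intro p hp q hq hpq
  rcases hX.2 p hp q hq with h | h | h
  · exact h
  · exact absurd (h _ (hm p hp) _ (hm q hq)) (by rw [hpq]; exact lt_irrefl _)
  · exact absurd (h _ (hm q hq) _ (hm p hp)) (by rw [hpq]; exact lt_irrefl _)

end PartialFunctions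

section BlockLists

variable {A : Type*}

/-- The located (variable) word represented by a list of blocks with letters to substitute. -/
def evalBlocks (l : List ((ℕ → Option (Option A)) × Option A)) : ℕ → Option (Option A) :=
  catW (l.map fun x => substV x.1 x.2)

/-- Nonempty increasing lists of blocks of `X` above `n`, with letters to substitute. -/
def IsBlockList (X : Set (ℕ → Option (Option A))) (n : ℕ)
    (l : List ((ℕ → Option (Option A)) × Option A)) : Prop :=
  l ≠ [] ∧ l.Pairwise (fun x y => blt x.1 y.1) ∧ ∀ x ∈ l, x.1 ∈ X ∧ domAbove x.1 n

theorem exists_dom_bound {X : Set (ℕ → Option (Option A))} (hX : IsBlockSeq X) (n : ℕ)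
    (l : List ((ℕ → Option (Option A)) × Option A)) :
    ∃ m, n ≤ m ∧ ((∀ x ∈ l, x.1 ∈ X) → ∀ x ∈ l, ∀ k ∈ dom x.1, k < m) := by
  by_cases hl : ∀ x ∈ l, x.1 ∈ X
  · have hfin : (⋃ x ∈ {x | x ∈ l}, dom x.1).Finite :=
      (List.finite_toSet l).biUnion fun x hx => (hX.1 _ (hl x hx)).1.1
    obtain ⟨m, hm⟩ := hfin.bddAbove
    refine ⟨max n (m + 1), le_max_left _ _, fun _ x hx k hk => ?_⟩
    have := hm (Set.mem_biUnion (show x ∈ {x | x ∈ l} from hx) hk)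
    omega
  · exact ⟨n, le_rfl, fun h => absurd h hl⟩

theorem IsBlockList.exists_append {X : Set (ℕ → Option (Option A))} (hX : IsBlockSeq X) {n : ℕ}
    {l : List ((ℕ → Option (Option A)) × Option A)} (hl : IsBlockList X n l) :
    ∃ m, ∀ l', IsBlockList X m l' → IsBlockList X n (l ++ l') := by
  obtain ⟨m, hnm, hm⟩ := exists_dom_bound hX n l
  have hm := hm fun x hx => (hl.2.2 x hx).1
  refine ⟨m, fun l' hl' => ⟨by simp [hl.1], ?_, fun x hx => ?_⟩⟩
  · exact List.pairwise_append.2 ⟨hl.2.1, hl'.2.1, fun x hx y hy j hj k hk =>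
      (hm x hx j hj).trans_le ((hl'.2.2 y hy).2 k hk)⟩
  · rcases List.mem_append.1 hx with h | h
    · exact hl.2.2 x h
    · exact ⟨(hl'.2.2 x h).1, fun k hk => hnm.trans ((hl'.2.2 x h).2 k hk)⟩

theorem IsBlockList.evalBlocks_mem_combV {X : Set (ℕ → Option (Option A))} {n : ℕ}
    {l : List ((ℕ → Option (Option A)) × Option A)} (hl : IsBlockList X n l)
    (hstar : ∃ x ∈ l, x.2 = none) : evalBlocks l ∈ combV X := by
  obtain ⟨hne, hlt, hX⟩ := hl
  obtain ⟨x, l, rfl⟩ := List.exists_cons_of_ne_nil hne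
  refine ⟨l.length, fun j => ((x :: l).get j).1, fun j => ((x :: l).get j).2,
    fun j => (hX _ (List.get_mem _ _)).1, fun i j hij => List.pairwise_iff_get.1 hlt i j hij, ?_, ?_⟩
  · obtain ⟨y, hy, hy'⟩ := hstar
    obtain ⟨j, rfl⟩ := List.get_of_mem hy
    exact ⟨j, hy'⟩
  · rw [famUnion_eq_catW, evalBlocks]
    congr 1
    conv_lhs => rw [← List.ofFn_get (x :: l), List.map_ofFn]
    rfl

theorem blt_evalBlocks {X : Set (ℕ → Option (Option A))} {m n : ℕ}
    {l l' : List ((ℕ → Option (Option A)) × Option A)}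
    (hm : ∀ x ∈ l, ∀ k ∈ dom x.1, k < m) (hmn : m ≤ n) (hl' : IsBlockList X n l') :
    blt (evalBlocks l) (evalBlocks l') := by
  intro j hj k hk
  simp only [evalBlocks, mem_dom_catW, List.mem_map] at hj hk
  obtain ⟨_, ⟨x, hx, rfl⟩, hj⟩ := hj
  obtain ⟨_, ⟨y, hy, rfl⟩, hk⟩ := hk
  rw [dom_substV] at hj hk
  exact (hm x hx j hj).trans_le (hmn.trans ((hl'.2.2 y hy).2 k hk))

/-- The homomorphism substituting the letter `a` for the variable in lists of blocks. -/
def substHom (a : A) : FreeMonoid ((ℕ → Option (Option A)) × Option A) →ₙ*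
    FreeMonoid ((ℕ → Option (Option A)) × Option A) :=
  (FreeMonoid.map fun x => (x.1, some (x.2.getD a))).toMulHom

theorem toList_substHom (a : A) (t : FreeMonoid ((ℕ → Option (Option A)) × Option A)) :
    (substHom a t).toList = t.toList.map fun x => (x.1, some (x.2.getD a)) := rfl

theorem substA_evalBlocks_substHom (a b : A)
    (t : FreeMonoid ((ℕ → Option (Option A)) × Option A)) :
    substA (evalBlocks (substHom a t).toList) b = substA (evalBlocks t.toList) a := by
  simp only [evalBlocks, substA_catW, toList_substHom, List.map_map]
  congr 1
  refine List.map_congr_left fun x _ => ?_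
  simp [substA_substV]

theorem IsBlockList.substHom {X : Set (ℕ → Option (Option A))} {n : ℕ} (a : A)
    {t : FreeMonoid ((ℕ → Option (Option A)) × Option A)} (ht : IsBlockList X n t.toList) :
    IsBlockList X n (substHom a t).toList := by
  obtain ⟨hne, hlt, hX⟩ := ht
  rw [toList_substHom]
  refine ⟨by simpa using hne, List.pairwise_map.2 hlt, fun x hx => ?_⟩
  obtain ⟨y, hy, rfl⟩ := List.mem_map.1 hx
  exact hX y hy

/-- **Carlson's theorem** for located words: below every infinite block sequence there is an
infinite block sequence all of whose constant combinations have the same color. -/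
theorem exists_monochromatic_combA {C : Type*} [Finite A] [Nonempty A] [Finite C]
    {X : Set (ℕ → Option (Option A))} (hX : IsBlockSeq X) (hXinf : X.Infinite)
    (f : (ℕ → Option A) → C) :
    ∃ (c : C) (p : ℕ → ℕ → Option (Option A)), (∀ k, p k ∈ combV X) ∧
      (∀ j k, j < k → blt (p j) (p k)) ∧ ∀ q ∈ combA (Set.range p), f q = c := by
  let T := FreeMonoid ((ℕ → Option (Option A)) × Option A)
  let a₀ : A := Classical.arbitrary A
  let W : ℕ → Set T := fun n => {t | IsBlockList X n t.toList ∧ ∀ x ∈ t.toList, x.2 ≠ none}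
  let V : ℕ → Set T := fun n => {t | IsBlockList X n t.toList ∧ ∃ x ∈ t.toList, x.2 = none}
  choose g _ hg using fun t : T => exists_dom_bound hX 0 t.toList
  have hmul : ∀ {Y Z P : ℕ → Set T}, (∀ n, ∀ s ∈ Y n, IsBlockList X n s.toList) →
      (∀ n, ∀ t ∈ Z n, IsBlockList X n t.toList) →
      (∀ m n, ∀ s ∈ Y n, ∀ t ∈ Z m, IsBlockList X n (s * t).toList → s * t ∈ P n) →
      MulTail Y Z P := by
    intro Y Z P hY hZ hP n s hs
    obtain ⟨m, hm⟩ := (hY n s hs).exists_append hX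
    exact ⟨m, fun t ht => hP m n s hs t ht (hm _ (hZ m t ht))⟩
  have hWl : ∀ n, ∀ s ∈ W n, IsBlockList X n s.toList := fun n s hs => hs.1
  have hVl : ∀ n, ∀ s ∈ V n, IsBlockList X n s.toList := fun n s hs => hs.1
  obtain ⟨c, y, hyV, hyg, hyc⟩ := exists_seq_prod_color_eq (W := W) (V := V) (σ := substHom)
    (fun m n hmn t ht => ⟨⟨ht.1.1, ht.1.2.1, fun x hx => ⟨(ht.1.2.2 x hx).1,
      fun k hk => hmn.trans ((ht.1.2.2 x hx).2 k hk)⟩⟩, ht.2⟩)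
    (fun n => by
      obtain ⟨p, hp, hpn⟩ := hX.exists_domAbove hXinf n
      refine ⟨FreeMonoid.of (p, none), ⟨?_, ?_, ?_⟩, ?_⟩ <;> simp [hp, hpn])
    (hmul hWl hWl fun m n s hs t ht h => ⟨h, fun x hx =>
      (List.mem_append.1 hx).elim (hs.2 x) (ht.2 x)⟩)
    (hmul hWl hVl fun m n s hs t ht h => ⟨h, ht.2.imp fun x hx =>
      ⟨List.mem_append_right _ hx.1, hx.2⟩⟩)
    (hmul hVl hWl fun m n s hs t ht h => ⟨h, hs.2.imp fun x hx =>
      ⟨List.mem_append_left _ hx.1, hx.2⟩⟩)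
    (hmul hVl hVl fun m n s hs t ht h => ⟨h, hs.2.imp fun x hx =>
      ⟨List.mem_append_left _ hx.1, hx.2⟩⟩)
    (fun a n t ht => ⟨ht.1.substHom a, fun x hx => by
      obtain ⟨y, -, rfl⟩ := List.mem_map.1 hx
      simp⟩)
    (fun a n t ht => by
      refine FreeMonoid.toList.injective ?_
      rw [toList_substHom]
      conv_rhs => rw [← List.map_id t.toList]
      refine List.map_congr_left fun x hx => ?_
      obtain ⟨b, hb⟩ := Option.ne_none_iff_exists'.1 (ht.2 x hx)
      ext1 <;> simp [hb])
    (fun t => f (substA (evalBlocks t.toList) a₀)) g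
  have hcomb : ∀ k, evalBlocks (y k).toList ∈ combV X := fun k =>
    (hyV k).elim fun n hn => hn.1.evalBlocks_mem_combV hn.2
  have hsucc : ∀ k, blt (evalBlocks (y k).toList) (evalBlocks (y (k + 1)).toList) := fun k =>
    blt_evalBlocks (hg (y k) fun x hx => (hyV k).elim fun n hn => (hn.1.2.2 x hx).1) le_rfl
      (hyg k).1
  have hblt : ∀ j k, j < k → blt (evalBlocks (y j).toList) (evalBlocks (y k).toList) := by
    intro j k hjk
    induction k, hjk using Nat.le_induction with
    | base => exact hsucc j
    | succ k _ ih => exact blt_trans (hX.isLVW_of_mem_combV (hcomb k)).1.2 ih (hsucc k)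
  refine ⟨c, fun k => evalBlocks (y k).toList, hcomb, hblt, ?_⟩
  rintro _ ⟨n, q, a, hq, hlt, rfl⟩
  choose κ hκ using hq
  have hκlt : ∀ i j, i < j → κ i < κ j := fun i j hij => by
    by_contra! hle
    obtain ⟨m, hm⟩ := (hX.isLVW_of_mem_combV (hcomb (κ j))).1.2
    obtain ⟨m', hm'⟩ := (hX.isLVW_of_mem_combV (hcomb (κ i))).1.2
    have h := hlt i j hij
    rw [← hκ i, ← hκ j] at h
    rcases hle.eq_or_lt with heq | hlt'
    · exact lt_irrefl m (h m (heq ▸ hm) m hm)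
    · exact lt_asymm (h m' hm' m hm) (hblt _ _ hlt' m hm m' hm')
  rw [← hyc (List.ofFn fun j => (κ j, a j)) (by simp)
    (List.pairwise_ofFn.2 fun i j hij => hκlt i j hij)]
  congr 1
  rw [famUnion_eq_catW, evalBlocks, FreeMonoid.toList_prod, List.map_flatten, catW_flatten,
    substA_catW]
  simp only [List.map_ofFn]
  congr 2
  funext j
  simp only [← hκ, Function.comp_apply]
  exact (substA_evalBlocks_substHom (a j) a₀ (y (κ j))).symm

end BlockLists

theorem pun_substA_mem_combA {A : Type*} {X Y : Set (ℕ → Option (Option A))}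
    {p : ℕ → Option (Option A)} (hp : p ∈ X) (hYX : Y ⊆ X) (hlt : ∀ r ∈ Y, blt p r) (a : A)
    {q : ℕ → Option A} (hq : q ∈ combA Y) : pun (substA p a) q ∈ combA X := by
  obtain ⟨k, r, b, hr, hrlt, rfl⟩ := hq
  refine ⟨k + 1, Fin.cons p r, Fin.cons a b, Fin.cases hp fun j => hYX (hr j), ?_, ?_⟩
  · refine Fin.cases (Fin.cases (fun h => absurd h (lt_irrefl _)) fun j _ => hlt _ (hr j))
      fun i => Fin.cases (fun h => absurd h (Fin.not_lt_zero _)) fun j hij => ?_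
    exact hrlt i j (Fin.succ_lt_succ_iff.1 hij)
  · rw [famUnion_eq_catW, famUnion_eq_catW, List.ofFn_succ (n := k + 1)]
    rfl

theorem isBlockSeq_range_infinite {A : Type*} {p : ℕ → ℕ → Option (Option A)}
    (hp : ∀ k, IsLVW (p k)) (hblt : ∀ j k, j < k → blt (p j) (p k)) :
    IsBlockSeq (Set.range p) ∧ (Set.range p).Infinite := by
  refine ⟨⟨Set.forall_mem_range.2 hp, ?_⟩, Set.infinite_range_of_injective ?_⟩
  · rintro _ ⟨j, rfl⟩ _ ⟨k, rfl⟩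
    rcases lt_trichotomy j k with h | rfl | h
    · exact Or.inr (Or.inl (hblt j k h))
    · exact Or.inl rfl
    · exact Or.inr (Or.inr (hblt k j h))
  · refine Function.Injective.of_lt_imp_ne fun j k hjk heq => ?_
    obtain ⟨m, hm⟩ := (hp k).1.2
    exact lt_irrefl m (hblt j k hjk m (heq ▸ hm) m hm)

/-- For every infinite block sequence `X`, coloring `f : [X]_A → C` and color `i ∈ C`,
there are a finite `F ⊆ [X]_{A⋆}` and an infinite block sequence `Y ⊆ [X − F]_{A⋆}`
such that `F` half-matches `Y` for color `i`. -/
theorem half_match_single_color {A C : Type*} [Fintype A] [Nonempty A] [Fintype C]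
    (X : Set (ℕ → Option (Option A))) (hX : IsBlockSeq X) (hXinf : X.Infinite)
    (f : (ℕ → Option A) → C) (i : C) :
    ∃ F : Set (ℕ → Option (Option A)), F.Finite ∧ F ⊆ combV X ∧
      ∃ Y : Set (ℕ → Option (Option A)), Y ⊆ combV (sminus X F) ∧
        IsBlockSeq Y ∧ Y.Infinite ∧
        ∀ q ∈ combA Y, f q = i → ∃ p ∈ F, ∀ a : A, f (pun (substA p a) q) = i := by
  obtain ⟨c, p, hp, hblt, hc⟩ := exists_monochromatic_combA hX hXinf f
  by_cases hci : c = i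
  · have hlt : ∀ r ∈ Set.range fun k => p (k + 1), blt (p 0) r :=
      Set.forall_mem_range.2 fun k => hblt 0 (k + 1) k.succ_pos
    have hY := isBlockSeq_range_infinite (p := fun k => p (k + 1))
      (fun k => hX.isLVW_of_mem_combV (hp (k + 1)))
      fun j k hjk => hblt _ _ (Nat.succ_lt_succ hjk)
    refine ⟨{p 0}, Set.finite_singleton _, Set.singleton_subset_iff.2 (hp 0), _, ?_, hY.1, hY.2,
      fun q hq _ => ⟨p 0, rfl, fun a => ?_⟩⟩
    · exact Set.range_subset_iff.2 fun k => mem_combV_sminus (hp (k + 1)) (hlt _ ⟨k, rfl⟩)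
    · rw [hc _ (pun_substA_mem_combA (Set.mem_range_self 0)
        (Set.range_subset_iff.2 fun k => Set.mem_range_self (k + 1)) hlt a hq), hci]
  · have hY := isBlockSeq_range_infinite (fun k => hX.isLVW_of_mem_combV (hp k)) hblt
    refine ⟨∅, Set.finite_empty, Set.empty_subset _, Set.range p, ?_, hY.1, hY.2,
      fun q hq hqi => absurd ((hc q hq).symm.trans hqi) hci⟩
    simpa [sminus] using Set.range_subset_iff.2 hp

end Carlson
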